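/- Let F_n and F be Herglotz functions, and let B ⊆ ℝ be a Borel set of finite positive Lebesgue measure. Suppose that for every Borel set A ⊆ B and every bounded open interval J = (c,d), ∫_A ω_{F_n(t)}(J) dt → ∫_A ω_{F(t)}(J) dt as n → ∞. Then F_n → F uniformly on compact subsets of ℂ⁺. -/

import Mathlib

open Filter Topology MeasureTheory Complex

/-- A Herglotz function: a holomorphic map of the upper half plane to itself. -/
def IsHerglotz (F : ℂ → ℂ) : Prop :=
  DifferentiableOn ℂ F {z : ℂ | 0 < z.im} ∧ ∀ z : ℂ, 0 < z.im → 0 < (F z).im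

/-- Harmonic measure of a Borel set S ⊆ ℝ seen from z ∈ ℂ⁺. -/
noncomputable def harmMeas (z : ℂ) (S : Set ℝ) : ℝ :=
  (1 / Real.pi) * ∫ t in S, z.im / ((t - z.re) ^ 2 + z.im ^ 2)

/-- The Poisson kernel of the upper half plane, with pole `z`, at the boundary point `t`. -/
noncomputable def halfPlanePoisson (z : ℂ) (t : ℝ) : ℝ :=
  (1 / Real.pi) * (z.im / ((t - z.re) ^ 2 + z.im ^ 2))

theorem harmMeas_eq_integral_poisson (z : ℂ) (S : Set ℝ) :
    harmMeas z S = ∫ t in S, halfPlanePoisson z t := by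
  simp only [harmMeas, halfPlanePoisson, integral_const_mul]

theorem halfPlanePoisson_nonneg {z : ℂ} (hz : 0 < z.im) (t : ℝ) : 0 ≤ halfPlanePoisson z t := by
  unfold halfPlanePoisson
  positivity

theorem halfPlanePoisson_eq_cauchyPDFReal {z : ℂ} (hz : 0 < z.im) :
    halfPlanePoisson z = ProbabilityTheory.cauchyPDFReal z.re z.im.toNNReal := by
  ext t
  rw [halfPlanePoisson, ProbabilityTheory.cauchyPDFReal_def, Real.coe_toNNReal _ hz.le]
  ring

theorem integrable_halfPlanePoisson {z : ℂ} (hz : 0 < z.im) : Integrable (halfPlanePoisson z) := by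
  rw [halfPlanePoisson_eq_cauchyPDFReal hz]
  exact ProbabilityTheory.integrable_cauchyPDFReal _

theorem integral_halfPlanePoisson {z : ℂ} (hz : 0 < z.im) : ∫ t, halfPlanePoisson z t = 1 := by
  rw [halfPlanePoisson_eq_cauchyPDFReal hz]
  exact ProbabilityTheory.integral_cauchyPDFReal_eq_one _ (Real.toNNReal_pos.2 hz).ne'

theorem measurable_halfPlanePoisson : Measurable (Function.uncurry halfPlanePoisson) := by
  unfold halfPlanePoisson Function.uncurry
  fun_prop

theorem integral_real_eq_zero_of_quadratic_decay {E : ℂ → ℂ} {C R₀ : ℝ}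
    (hE : DifferentiableOn ℂ E {w | 0 ≤ w.im})
    (hdecay : ∀ w : ℂ, 0 ≤ w.im → R₀ ≤ ‖w‖ → ‖E w‖ ≤ C / ‖w‖ ^ 2)
    (h_int : Integrable fun t : ℝ => E t) : ∫ t : ℝ, E t = 0 := by
  have hlim := intervalIntegral_tendsto_integral h_int tendsto_neg_atTop_atBot
    (tendsto_id (α := ℝ))
  refine tendsto_nhds_unique hlim ?_
  have hC : Tendsto (fun R : ℝ => 4 * C * R⁻¹) atTop (𝓝 0) := by
    simpa using tendsto_inv_atTop_zero.const_mul (4 * C)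
  refine squeeze_zero_norm' ?_ hC
  filter_upwards [eventually_ge_atTop R₀, eventually_gt_atTop 0] with R hR hR0
  have hrect := integral_boundary_rect_eq_zero_of_differentiableOn E (((-R : ℝ) : ℂ))
    (⟨R, R⟩ : ℂ) (hE.mono ?_)
  · have hC0 : 0 ≤ C := by
      have h := (norm_nonneg _).trans (hdecay (R : ℂ) (by simp) (by simp [abs_of_pos hR0, hR]))
      by_contra hneg
      have : C / ‖(R : ℂ)‖ ^ 2 < 0 := div_neg_of_neg_of_pos (not_le.1 hneg) (by
        have : (R : ℂ) ≠ 0 := by exact_mod_cast hR0.ne'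
        positivity)
      linarith
    have key : ∀ w : ℂ, 0 ≤ w.im → R ≤ ‖w‖ → ‖E w‖ ≤ C / R ^ 2 := fun w hw hwR =>
      (hdecay w hw (hR.trans hwR)).trans (by gcongr)
    have htop : ‖∫ x : ℝ in (-R)..R, E (x + R * I)‖ ≤ C / R ^ 2 * |R - (-R)| := by
      refine intervalIntegral.norm_integral_le_of_norm_le_const fun x hx => key _ ?_ ?_
      · simp [hR0.le]
      · refine le_trans ?_ (Complex.abs_im_le_norm _)
        simp [abs_of_pos hR0]
    have hside : ∀ s : ℝ, |s| = R → ‖∫ y : ℝ in (0 : ℝ)..R, E (s + y * I)‖ ≤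
        C / R ^ 2 * |R - 0| := by
      intro s hs
      refine intervalIntegral.norm_integral_le_of_norm_le_const fun x hx => key _ ?_ ?_
      · rw [Set.uIoc_of_le hR0.le] at hx
        simp [hx.1.le]
      · refine le_trans ?_ (Complex.abs_re_le_norm _)
        simp [hs]
    have hr := hside R (abs_of_pos hR0)
    have hl := hside (-R) (by rw [abs_neg, abs_of_pos hR0])
    simp only [ofReal_re, ofReal_im, ofReal_zero, zero_mul, add_zero, smul_eq_mul] at hrect
    have heq : ∫ x : ℝ in (-R)..R, E x = (∫ x : ℝ in (-R)..R, E (x + R * I)) -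
        I * (∫ y : ℝ in (0 : ℝ)..R, E (R + y * I)) +
        I * (∫ y : ℝ in (0 : ℝ)..R, E ((-R : ℝ) + y * I)) := by
      linear_combination hrect
    simp only [id_eq]
    rw [heq]
    refine (norm_add_le _ _).trans ((add_le_add_left (norm_sub_le _ _) _).trans ?_)
    rw [norm_mul, norm_mul, norm_I, one_mul, one_mul]
    rw [abs_of_pos (by linarith)] at htop hr hl
    calc _ ≤ C / R ^ 2 * (R - (-R)) + C / R ^ 2 * (R - 0) + C / R ^ 2 * (R - 0) := by gcongr
      _ = 4 * C * R⁻¹ := by field_simp; ring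
  · intro w hw
    rw [mem_reProdIm] at hw
    have := hw.2
    simp only [ofReal_im] at this
    rw [Set.uIcc_of_le hR0.le] at this
    exact this.1

theorem ofReal_sub_ne_zero {z : ℂ} (hz : z.im ≠ 0) (t : ℝ) : (t : ℂ) - z ≠ 0 := by
  intro h
  apply hz
  simpa using congrArg Complex.im h

theorem halfPlanePoisson_ofReal (z : ℂ) (t : ℝ) : (halfPlanePoisson z t : ℂ) =
    (z.im / Real.pi : ℝ) * (((t : ℂ) - z) * (t - starRingEnd ℂ z))⁻¹ := by
  have : ((t : ℂ) - z) * (t - starRingEnd ℂ z) = (((t - z.re) ^ 2 + z.im ^ 2 : ℝ) : ℂ) := by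
    rw [pow_two, pow_two]
    apply Complex.ext
    · simp
    · simp
      ring
  rw [this, halfPlanePoisson, ← ofReal_inv, ← ofReal_mul]
  congr 1
  ring

/-- The Poisson formula for a bounded function holomorphic across the real line. -/
theorem integral_halfPlanePoisson_mul {G : ℂ → ℂ} {ε M : ℝ} (hε : 0 < ε)
    (hG : DifferentiableOn ℂ G {w | -ε < w.im}) (hM : ∀ w : ℂ, 0 ≤ w.im → ‖G w‖ ≤ M)
    {z : ℂ} (hz : 0 < z.im) : ∫ t : ℝ, (halfPlanePoisson z t : ℂ) * G t = G z := by
  have hopen : IsOpen {w : ℂ | -ε < w.im} := isOpen_lt continuous_const continuous_im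
  have hsub : {w : ℂ | 0 ≤ w.im} ⊆ {w : ℂ | -ε < w.im} := fun w (hw : 0 ≤ w.im) => by
    show -ε < w.im
    linarith
  have hzmem : {w : ℂ | -ε < w.im} ∈ 𝓝 z := hopen.mem_nhds (by show -ε < z.im; linarith)
  have hGt : Continuous fun t : ℝ => G t :=
    (hG.continuousOn.comp_continuous continuous_ofReal fun t => by simpa using hε)
  have hPint : Integrable fun t : ℝ => (halfPlanePoisson z t : ℂ) :=
    (integrable_halfPlanePoisson hz).ofReal
  have hPG : Integrable fun t : ℝ => (halfPlanePoisson z t : ℂ) * G t :=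
    hPint.mul_bdd hGt.aestronglyMeasurable (.of_forall fun t => hM t (by simp))
  set c : ℂ := ((z.im / Real.pi : ℝ) : ℂ) with hc
  have hconj : ∀ w : ℂ, 0 ≤ w.im → w - starRingEnd ℂ z ≠ 0 := by
    intro w hw h
    have := congrArg Complex.im h
    simp at this
    linarith
  have hEt : ∀ t : ℝ, c * (dslope G z t * (t - starRingEnd ℂ z)⁻¹) =
      (halfPlanePoisson z t : ℂ) * G t - (halfPlanePoisson z t : ℂ) * G z := by
    intro t
    have h1 := ofReal_sub_ne_zero hz.ne' t
    rw [dslope_of_ne _ (sub_ne_zero.1 h1), slope_def_field, halfPlanePoisson_ofReal]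
    rw [mul_inv]
    ring
  have hzero : ∫ t : ℝ, c * (dslope G z t * ((t : ℂ) - starRingEnd ℂ z)⁻¹) = 0 := by
    refine integral_real_eq_zero_of_quadratic_decay
      (E := fun w => c * (dslope G z w * (w - starRingEnd ℂ z)⁻¹)) (R₀ := 2 * ‖z‖)
      (C := ‖c‖ * (8 * M)) ?_ ?_ ?_
    · refine DifferentiableOn.const_mul (DifferentiableOn.mul ?_ ?_) _
      · exact ((differentiableOn_dslope hzmem).2 hG).mono hsub
      · exact DifferentiableOn.inv (by fun_prop) fun w hw => hconj w hw
    · intro w hw hwz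
      have hz0 : 0 < ‖z‖ := norm_pos_iff.2 (by rintro rfl; simp at hz)
      have hw0 : 0 < ‖w‖ := by linarith
      have hM0 : 0 ≤ M := (norm_nonneg _).trans (hM w hw)
      have h1 : ‖w‖ / 2 ≤ ‖w - z‖ := by
        have := norm_sub_norm_le w z
        linarith
      have h2 : ‖w‖ / 2 ≤ ‖w - starRingEnd ℂ z‖ := by
        have := norm_sub_norm_le w (starRingEnd ℂ z)
        rw [RCLike.norm_conj] at this
        linarith
      have hne : w ≠ z := by
        rintro rfl
        linarith
      rw [dslope_of_ne _ hne, slope_def_field, norm_mul, norm_mul, norm_div, norm_inv]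
      have h3 : ‖G w - G z‖ ≤ 2 * M := by
        have := norm_sub_le (G w) (G z)
        have := hM w hw
        have := hM z hz.le
        linarith
      calc _ ≤ ‖c‖ * (2 * M / (‖w‖ / 2) * (‖w‖ / 2)⁻¹) := by gcongr
        _ = _ := by field_simp; ring
    · simp only [hEt]
      exact hPG.sub (hPint.mul_const _)
  simp only [hEt] at hzero
  rw [integral_sub hPG (hPint.mul_const _), integral_mul_const, integral_complex_ofReal,
    integral_halfPlanePoisson hz] at hzero
  simpa using sub_eq_zero.1 hzero

theorem tendsto_one_div_add_one_nhdsGT_zero :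
    Tendsto (fun m : ℕ => 1 / ((m : ℝ) + 1)) atTop (𝓝[>] 0) :=
  tendsto_nhdsWithin_iff.2 ⟨tendsto_one_div_add_atTop_nhds_zero_nat,
    .of_forall fun _ => Set.mem_Ioi.2 Nat.one_div_pos_of_nat⟩

theorem isOpen_halfPlane (a : ℝ) : IsOpen {w : ℂ | a < w.im} :=
  isOpen_lt continuous_const continuous_im

theorem continuous_horizontal {f : ℂ → ℂ} (hf : ContinuousOn f {w : ℂ | 0 < w.im}) {y : ℝ}
    (hy : 0 < y) : Continuous fun t : ℝ => f (t + y * I) :=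
  hf.comp_continuous (by fun_prop) fun t => by simpa using hy

theorem aestronglyMeasurable_boundary {f : ℂ → ℂ} (hf : ContinuousOn f {w : ℂ | 0 < w.im})
    {fb : ℝ → ℂ} (hfb : ∀ᵐ t : ℝ, Tendsto (fun y : ℝ => f (t + y * I)) (𝓝[>] 0) (𝓝 (fb t))) :
    AEStronglyMeasurable fb := by
  refine aestronglyMeasurable_of_tendsto_ae atTop
    (f := fun (m : ℕ) (t : ℝ) => f (t + (1 / ((m : ℝ) + 1) : ℝ) * I)) (fun m => ?_) ?_
  · exact (continuous_horizontal hf Nat.one_div_pos_of_nat).aestronglyMeasurable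
  · filter_upwards [hfb] with t ht
    exact ht.comp tendsto_one_div_add_one_nhdsGT_zero

theorem norm_boundary_le {f : ℂ → ℂ} {M : ℝ} (hM : ∀ w : ℂ, 0 < w.im → ‖f w‖ ≤ M)
    {t : ℝ} {a : ℂ} (h : Tendsto (fun y : ℝ => f (t + y * I)) (𝓝[>] 0) (𝓝 a)) : ‖a‖ ≤ M := by
  refine le_of_tendsto h.norm ?_
  filter_upwards [self_mem_nhdsWithin] with y hy
  exact hM _ (by simpa using hy)

/-- The Poisson formula for a bounded function with vertical boundary limits almost everywhere,
multiplied by a bounded function holomorphic across the real line. -/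
theorem integral_halfPlanePoisson_mul_boundary {f k : ℂ → ℂ} {M M' δ : ℝ} (hδ : 0 < δ)
    (hf : DifferentiableOn ℂ f {w | 0 < w.im}) (hM : ∀ w : ℂ, 0 < w.im → ‖f w‖ ≤ M)
    (hk : DifferentiableOn ℂ k {w | -δ < w.im}) (hM' : ∀ w : ℂ, 0 ≤ w.im → ‖k w‖ ≤ M')
    {fb : ℝ → ℂ} (hfb : ∀ᵐ t : ℝ, Tendsto (fun y : ℝ => f (t + y * I)) (𝓝[>] 0) (𝓝 (fb t)))
    {z : ℂ} (hz : 0 < z.im) :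
    ∫ t : ℝ, (halfPlanePoisson z t : ℂ) * (fb t * k t) = f z * k z := by
  set e : ℕ → ℝ := fun m => 1 / ((m : ℝ) + 1) with he
  have he0 : ∀ m, 0 < e m := fun m => Nat.one_div_pos_of_nat
  have hpoisson : ∀ m, ∫ t : ℝ, (halfPlanePoisson z t : ℂ) * (f (t + e m * I) * k t) =
      f (z + e m * I) * k z := by
    intro m
    refine integral_halfPlanePoisson_mul (G := fun w => f (w + e m * I) * k w)
      (lt_min hδ (he0 m)) (M := M * M') ?_ ?_ hz
    · refine DifferentiableOn.mul ?_ (hk.mono fun w hw => ?_)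
      · refine hf.comp (by fun_prop) fun w hw => ?_
        have h1 : -min δ (e m) < w.im := hw
        have h2 := min_le_right δ (e m)
        have : 0 < w.im + e m := by linarith
        simpa using this
      · have h1 : -min δ (e m) < w.im := hw
        have h2 := min_le_left δ (e m)
        show -δ < w.im
        linarith
    · intro w hw
      have h1 : 0 < (w + e m * I).im := by
        have := he0 m
        simp
        linarith
      rw [norm_mul]
      exact mul_le_mul (hM _ h1) (hM' _ hw) (norm_nonneg _) ((norm_nonneg _).trans (hM _ h1))
  have hkt : Continuous fun t : ℝ => k t :=
    hk.continuousOn.comp_continuous continuous_ofReal fun t => by simpa using hδ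
  have hPint : Integrable fun t : ℝ => (halfPlanePoisson z t : ℂ) :=
    (integrable_halfPlanePoisson hz).ofReal
  have hM0 : 0 ≤ M := (norm_nonneg _).trans (hM z hz)
  have hleft : Tendsto (fun m => ∫ t : ℝ, (halfPlanePoisson z t : ℂ) * (f (t + e m * I) * k t))
      atTop (𝓝 (∫ t : ℝ, (halfPlanePoisson z t : ℂ) * (fb t * k t))) := by
    refine tendsto_integral_of_dominated_convergence
      (fun t => halfPlanePoisson z t * (M * M')) ?_ ?_ ?_ ?_
    · intro m
      exact hPint.aestronglyMeasurable.mul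
        ((continuous_horizontal hf.continuousOn (he0 m)).mul hkt).aestronglyMeasurable
    · exact (integrable_halfPlanePoisson hz).mul_const _
    · refine fun m => .of_forall fun t => ?_
      rw [norm_mul, norm_mul, norm_real, Real.norm_of_nonneg (halfPlanePoisson_nonneg hz t)]
      refine mul_le_mul_of_nonneg_left ?_ (halfPlanePoisson_nonneg hz t)
      exact mul_le_mul (hM _ (by simpa using he0 m)) (hM' _ (by simp)) (norm_nonneg _) hM0
    · filter_upwards [hfb] with t ht
      exact ((ht.comp tendsto_one_div_add_one_nhdsGT_zero).mul_const _).const_mul _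
  refine tendsto_nhds_unique hleft ?_
  simp only [hpoisson]
  refine Tendsto.mul_const _ ?_
  have hcont : ContinuousAt f z := (hf.continuousOn).continuousAt ((isOpen_halfPlane 0).mem_nhds hz)
  refine hcont.tendsto.comp ?_
  have : Tendsto (fun m => z + (e m : ℂ) * I) atTop (𝓝 (z + ((0 : ℝ) : ℂ) * I)) :=
    (((continuous_ofReal.tendsto 0).comp tendsto_one_div_add_atTop_nhds_zero_nat).mul_const
      _).const_add _
  simpa using this

/-- Bounded functions whose integrals over all measurable subsets of `B` tend to zero also tend to
zero on `B` when tested against integrable functions. -/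
theorem tendsto_setIntegral_mul_of_tendsto_setIntegral {B : Set ℝ} (hB : MeasurableSet B)
    {u : ℕ → ℝ → ℂ} {M : ℝ} (hu : ∀ n, AEStronglyMeasurable (u n))
    (huM : ∀ n, ∀ᵐ t, ‖u n t‖ ≤ M)
    (hw : ∀ A ⊆ B, MeasurableSet A → Tendsto (fun n => ∫ t in A, u n t) atTop (𝓝 0))
    {q : ℝ → ℂ} (hq : Integrable q) :
    Tendsto (fun n => ∫ t in B, q t * u n t) atTop (𝓝 0) := by
  have h_int : ∀ {q : ℝ → ℂ}, Integrable q → ∀ n, Integrable fun t => q t * u n t :=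
    fun hq n => hq.mul_bdd (hu n) (huM n)
  have hM0 : 0 ≤ M := by
    obtain ⟨t, ht⟩ := (huM 0).exists
    exact (norm_nonneg _).trans ht
  refine Integrable.induction
    (P := fun q => Tendsto (fun n => ∫ t in B, q t * u n t) atTop (𝓝 0)) ?_ ?_ ?_ ?_ hq
  · intro c s hs _
    have heq : ∀ n, ∫ t in B, s.indicator (fun _ => c) t * u n t = c * ∫ t in B ∩ s, u n t := by
      intro n
      rw [← setIntegral_indicator hs, ← integral_const_mul]
      congr 1
      ext t
      by_cases ht : t ∈ s <;> simp [ht]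
    simp only [heq]
    simpa using (hw (B ∩ s) Set.inter_subset_left (hB.inter hs)).const_mul c
  · intro f g _ hf hg hPf hPg
    have heq : ∀ n, ∫ t in B, (f + g) t * u n t =
        (∫ t in B, f t * u n t) + ∫ t in B, g t * u n t := by
      intro n
      rw [← integral_add (h_int hf n).integrableOn (h_int hg n).integrableOn]
      simp only [Pi.add_apply, add_mul]
    simp only [heq]
    simpa using hPf.add hPg
  · refine isClosed_of_closure_subset fun f hf => ?_
    rw [Metric.mem_closure_iff] at hf
    rw [Set.mem_ofPred_eq, Metric.tendsto_atTop]
    intro ε hε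
    obtain ⟨g, hg, hfg⟩ := hf (ε / (2 * (M + 1))) (by positivity)
    rw [Set.mem_ofPred_eq, Metric.tendsto_atTop] at hg
    obtain ⟨n₀, hn₀⟩ := hg (ε / 2) (by positivity)
    refine ⟨n₀, fun n hn => ?_⟩
    have h1 := hn₀ n hn
    rw [dist_zero_right] at h1 ⊢
    have hfi := L1.integrable_coeFn f
    have hgi := L1.integrable_coeFn g
    have h2 : ‖(∫ t in B, f t * u n t) - ∫ t in B, g t * u n t‖ ≤ dist f g * M := by
      rw [← integral_sub (h_int hfi n).integrableOn (h_int hgi n).integrableOn,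
        L1.dist_eq_integral_dist, ← integral_mul_const]
      have hdi : Integrable fun t => dist (f t) (g t) * M := by
        simp only [dist_eq_norm]
        exact (hfi.sub hgi).norm.mul_const M
      refine (norm_integral_le_of_norm_le hdi.integrableOn ?_).trans
        (setIntegral_le_integral hdi (.of_forall fun t => by positivity))
      filter_upwards [ae_restrict_of_ae (huM n)] with t ht
      rw [← sub_mul, norm_mul, dist_eq_norm]
      gcongr
    have h3 : dist f g * M ≤ ε / 2 := by
      calc dist f g * M ≤ ε / (2 * (M + 1)) * (M + 1) := by
            gcongr
            linarith
        _ = ε / 2 := by field_simp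
    have h4 := norm_sub_norm_le (∫ t in B, f t * u n t) (∫ t in B, g t * u n t)
    linarith
  · intro f g hfg _ hf
    refine hf.congr fun n => integral_congr_ae ?_
    filter_upwards [ae_restrict_of_ae hfg] with t ht
    rw [ht]

/-- The Cauchy transform of `B`, normalised so that its real part on the upper half plane is the
harmonic measure of `B`. -/
noncomputable def cauchyTransform (B : Set ℝ) (w : ℂ) : ℂ :=
  ∫ s in B, (-I / Real.pi) * ((s : ℂ) - w)⁻¹

theorem im_le_norm_ofReal_sub {w : ℂ} (hw : 0 < w.im) (s : ℝ) : w.im ≤ ‖(s : ℂ) - w‖ := by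
  have := Complex.abs_im_le_norm ((s : ℂ) - w)
  simpa [abs_of_pos hw] using this

theorem continuous_inv_ofReal_sub {w : ℂ} (hw : 0 < w.im) :
    Continuous fun s : ℝ => ((s : ℂ) - w)⁻¹ :=
  Continuous.inv₀ (by fun_prop) fun s => ofReal_sub_ne_zero hw.ne' s

theorem integrableOn_cauchyKernel {B : Set ℝ} (hfin : volume B < ⊤) {w : ℂ} (hw : 0 < w.im) :
    IntegrableOn (fun s : ℝ => (-I / Real.pi) * ((s : ℂ) - w)⁻¹) B := by
  refine Integrable.const_mul ?_ _
  refine IntegrableOn.of_bound hfin (continuous_inv_ofReal_sub hw).aestronglyMeasurable (w.im)⁻¹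
    (.of_forall fun s => ?_)
  rw [norm_inv]
  exact inv_anti₀ hw (im_le_norm_ofReal_sub hw s)

theorem differentiableOn_cauchyTransform {B : Set ℝ} (hfin : volume B < ⊤) :
    DifferentiableOn ℂ (cauchyTransform B) {w | 0 < w.im} := by
  intro w₀ (hw₀ : 0 < w₀.im)
  have hpos : 0 < w₀.im / 2 := half_pos hw₀
  have hmem : {w : ℂ | w₀.im / 2 < w.im} ∈ 𝓝 w₀ :=
    (isOpen_halfPlane _).mem_nhds (half_lt_self hw₀)
  refine (hasDerivAt_integral_of_dominated_loc_of_deriv_le (μ := volume.restrict B)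
    (F := fun w (s : ℝ) => (-I / Real.pi) * ((s : ℂ) - w)⁻¹)
    (F' := fun w (s : ℝ) => (-I / Real.pi) * (((s : ℂ) - w) ^ 2)⁻¹)
    (bound := fun _ => ‖(-I / Real.pi : ℂ)‖ * ((w₀.im / 2) ^ 2)⁻¹)
    hmem ?_ (integrableOn_cauchyKernel hfin hw₀) ?_ ?_ ?_
    ?_).2.differentiableAt.differentiableWithinAt
  · filter_upwards [hmem] with w hw
    exact (integrableOn_cauchyKernel hfin (hpos.trans hw)).aestronglyMeasurable
  · refine Continuous.aestronglyMeasurable ?_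
    exact continuous_const.mul (Continuous.inv₀ (by fun_prop) fun s =>
      pow_ne_zero _ (ofReal_sub_ne_zero hw₀.ne' s))
  · refine .of_forall fun s w (hw : w₀.im / 2 < w.im) => ?_
    rw [norm_mul, norm_inv, norm_pow]
    have := im_le_norm_ofReal_sub (hpos.trans hw) s
    gcongr
    linarith
  · have : IsFiniteMeasure (volume.restrict B) := isFiniteMeasure_restrict.2 hfin.ne
    exact integrable_const _
  · refine .of_forall fun s w (hw : w₀.im / 2 < w.im) => ?_
    have hne := ofReal_sub_ne_zero (hpos.trans hw).ne' s
    have h := ((((hasDerivAt_id w).const_sub (s : ℂ)).inv hne).const_mul (-I / Real.pi : ℂ))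
    refine h.congr_deriv ?_
    simp [div_eq_mul_inv]

theorem cauchyTransform_re {B : Set ℝ} (hfin : volume B < ⊤) {w : ℂ} (hw : 0 < w.im) :
    (cauchyTransform B w).re = ∫ s in B, halfPlanePoisson w s := by
  have h := reCLM.integral_comp_comm (integrableOn_cauchyKernel hfin hw)
  simp only [reCLM_apply] at h
  rw [cauchyTransform, ← h]
  refine integral_congr_ae (.of_forall fun s => ?_)
  have hsq : normSq ((s : ℂ) - w) = (s - w.re) ^ 2 + w.im ^ 2 := by
    simp [normSq_apply]
    ring
  have hre : (-I / (Real.pi : ℂ) * ((s : ℂ) - w)⁻¹) =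
      ((1 / Real.pi : ℝ) : ℂ) * (-I * ((s : ℂ) - w)⁻¹) := by
    push_cast
    ring
  simp only [hre, re_ofReal_mul, halfPlanePoisson]
  simp [inv_im, hsq]

theorem cauchyTransform_re_nonneg {B : Set ℝ} (hfin : volume B < ⊤) {w : ℂ} (hw : 0 < w.im) :
    0 ≤ (cauchyTransform B w).re := by
  rw [cauchyTransform_re hfin hw]
  exact integral_nonneg fun s => halfPlanePoisson_nonneg hw s

theorem cauchyTransform_re_le_one {B : Set ℝ} (hfin : volume B < ⊤) {w : ℂ} (hw : 0 < w.im) :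
    (cauchyTransform B w).re ≤ 1 := by
  rw [cauchyTransform_re hfin hw, ← integral_halfPlanePoisson hw]
  exact setIntegral_le_integral (integrable_halfPlanePoisson hw)
    (.of_forall fun s => halfPlanePoisson_nonneg hw s)

theorem cauchyTransform_re_pos {B : Set ℝ} (hfin : volume B < ⊤) (hpos : 0 < volume B) {w : ℂ}
    (hw : 0 < w.im) : 0 < (cauchyTransform B w).re := by
  rw [cauchyTransform_re hfin hw, setIntegral_pos_iff_support_of_nonneg_ae
    (.of_forall fun s => halfPlanePoisson_nonneg hw s) (integrable_halfPlanePoisson hw).integrableOn]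
  have : Function.support (halfPlanePoisson w) = Set.univ := by
    ext s
    simp only [Function.mem_support, Set.mem_univ, iff_true, halfPlanePoisson]
    positivity
  rwa [this, Set.univ_inter]

theorem tendsto_cauchyTransform_re_of_notMem {B : Set ℝ} (hB : IsClosed B) (hfin : volume B < ⊤)
    {t : ℝ} (ht : t ∉ B) :
    Tendsto (fun δ : ℝ => (cauchyTransform B (t + δ * I)).re) (𝓝[>] 0) (𝓝 0) := by
  obtain ⟨r, hr, hball⟩ := Metric.isOpen_iff.1 hB.isOpen_compl t ht
  have hbound : Tendsto (fun δ : ℝ => (1 / Real.pi) * (δ / r ^ 2) * volume.real B) (𝓝[>] 0)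
      (𝓝 0) := by
    have : Continuous fun δ : ℝ => (1 / Real.pi) * (δ / r ^ 2) * volume.real B := by fun_prop
    simpa using (this.tendsto 0).mono_left nhdsWithin_le_nhds
  refine squeeze_zero' ?_ ?_ hbound
  · filter_upwards [self_mem_nhdsWithin] with δ (hδ : 0 < δ)
    exact cauchyTransform_re_nonneg hfin (by simpa using hδ)
  · filter_upwards [self_mem_nhdsWithin] with δ (hδ : 0 < δ)
    have him : 0 < ((t : ℂ) + δ * I).im := by simpa using hδ
    rw [cauchyTransform_re hfin him]
    refine (Real.le_norm_self _).trans ?_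
    refine norm_setIntegral_le_of_norm_le_const hfin fun s hs => ?_
    rw [Real.norm_of_nonneg (halfPlanePoisson_nonneg him s), halfPlanePoisson]
    have hdist : r ≤ |s - t| := by
      by_contra! h
      exact hball (by simpa [Real.dist_eq] using h) hs
    have : r ^ 2 ≤ (s - t) ^ 2 := by
      rw [← sq_abs (s - t)]
      gcongr
    simp only [add_im, ofReal_im, mul_im, ofReal_re, I_im, mul_one, I_re, mul_zero, add_zero,
      zero_add, add_re, mul_re, sub_zero]
    gcongr
    nlinarith [sq_nonneg δ]

/-- Uniformly bounded holomorphic functions on the upper half plane whose boundary values tend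
weakly to zero on a closed set of positive finite measure tend to zero pointwise. -/
theorem tendsto_zero_of_tendsto_setIntegral_boundary {f : ℕ → ℂ → ℂ} {M : ℝ}
    (hf : ∀ n, DifferentiableOn ℂ (f n) {w | 0 < w.im})
    (hM : ∀ n, ∀ w : ℂ, 0 < w.im → ‖f n w‖ ≤ M) {fb : ℕ → ℝ → ℂ}
    (hfb : ∀ n, ∀ᵐ t : ℝ, Tendsto (fun y : ℝ => f n (t + y * I)) (𝓝[>] 0) (𝓝 (fb n t)))
    {B : Set ℝ} (hB : IsClosed B) (hfin : volume B < ⊤) (hpos : 0 < volume B)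
    (hw : ∀ A ⊆ B, MeasurableSet A → Tendsto (fun n => ∫ t in A, fb n t) atTop (𝓝 0))
    {z : ℂ} (hz : 0 < z.im) : Tendsto (fun n => f n z) atTop (𝓝 0) := by
  have hM0 : 0 ≤ M := (norm_nonneg _).trans (hM 0 z hz)
  have hfbm : ∀ n, AEStronglyMeasurable (fb n) := fun n =>
    aestronglyMeasurable_boundary (hf n).continuousOn (hfb n)
  have hfbM : ∀ n, ∀ᵐ t, ‖fb n t‖ ≤ M := fun n => by
    filter_upwards [hfb n] with t ht
    exact norm_boundary_le (hM n) ht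
  set p := (cauchyTransform B z).re with hp
  have hp0 : 0 < p := cauchyTransform_re_pos hfin hpos hz
  have hPint := integrable_halfPlanePoisson hz
  have hPC : Integrable fun t : ℝ => (halfPlanePoisson z t : ℂ) := hPint.ofReal
  have himδ : ∀ {δ : ℝ}, 0 < δ → ∀ w : ℂ, 0 ≤ w.im → 0 < (w + δ * I).im := by
    intro δ hδ w hw
    simp
    linarith
  have hkdiff : ∀ (N : ℝ) {δ : ℝ}, DifferentiableOn ℂ
      (fun w => exp (N * cauchyTransform B (w + δ * I))) {w | -δ < w.im} := by
    intro N δ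
    refine DifferentiableOn.cexp (DifferentiableOn.const_mul ?_ _)
    refine (differentiableOn_cauchyTransform hfin).comp (by fun_prop) fun w (hw : -δ < w.im) => ?_
    show 0 < (w + δ * I).im
    simp
    linarith
  have hknorm : ∀ (N δ : ℝ) (w : ℂ), ‖exp (N * cauchyTransform B (w + δ * I))‖ =
      Real.exp (N * (cauchyTransform B (w + δ * I)).re) := by
    intro N δ w
    rw [norm_exp, re_ofReal_mul]
  have hkle : ∀ {N : ℝ}, 0 ≤ N → ∀ {δ : ℝ}, 0 < δ → ∀ w : ℂ, 0 ≤ w.im →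
      ‖exp (N * cauchyTransform B (w + δ * I))‖ ≤ Real.exp N := by
    intro N hN δ hδ w hw
    rw [hknorm]
    refine Real.exp_le_exp.2 (mul_le_of_le_one_right hN ?_)
    exact cauchyTransform_re_le_one hfin (himδ hδ w hw)
  have hkcont : ∀ (N : ℝ) {δ : ℝ}, 0 < δ →
      Continuous fun t : ℝ => exp (N * cauchyTransform B ((t : ℂ) + δ * I)) := by
    intro N δ hδ
    exact (hkdiff N).continuousOn.comp_continuous continuous_ofReal fun t => by simpa using hδ
  have hnonneg : ∀ t, 0 ≤ halfPlanePoisson z t := halfPlanePoisson_nonneg hz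
  have hshift : ∀ N : ℝ, 0 ≤ N → ∃ δ : ℝ, 0 < δ ∧ p / 2 < (cauchyTransform B (z + δ * I)).re ∧
      ∫ t in Bᶜ, halfPlanePoisson z t *
        ‖exp (N * cauchyTransform B ((t : ℂ) + δ * I))‖ < 2 := by
    intro N hN
    have h1 : Tendsto (fun m : ℕ => ∫ t in Bᶜ, halfPlanePoisson z t *
        ‖exp (N * cauchyTransform B ((t : ℂ) + (1 / ((m : ℝ) + 1) : ℝ) * I))‖) atTop
        (𝓝 (∫ t in Bᶜ, halfPlanePoisson z t * 1)) := by
      refine tendsto_integral_of_dominated_convergence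
        (fun t => halfPlanePoisson z t * Real.exp N) ?_ ?_ ?_ ?_
      · intro m
        exact hPint.aestronglyMeasurable.restrict.mul
          (hkcont N Nat.one_div_pos_of_nat).norm.aestronglyMeasurable
      · exact (hPint.mul_const _).integrableOn
      · refine fun m => .of_forall fun t => ?_
        rw [norm_mul, norm_norm, Real.norm_of_nonneg (hnonneg t)]
        exact mul_le_mul_of_nonneg_left (hkle hN Nat.one_div_pos_of_nat _ (by simp)) (hnonneg t)
      · filter_upwards [ae_restrict_mem hB.measurableSet.compl] with t ht
        have h := (tendsto_cauchyTransform_re_of_notMem hB hfin ht).comp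
          tendsto_one_div_add_one_nhdsGT_zero
        simp only [hknorm]
        have h' := ((h.const_mul N).rexp).const_mul (halfPlanePoisson z t)
        simpa using h'
    have h2 : ∫ t in Bᶜ, halfPlanePoisson z t * 1 < 2 := by
      simp only [mul_one]
      refine lt_of_le_of_lt (setIntegral_le_integral hPint (.of_forall hnonneg)) ?_
      rw [integral_halfPlanePoisson hz]
      norm_num
    have h3 : Tendsto (fun m : ℕ => (cauchyTransform B (z + (1 / ((m : ℝ) + 1) : ℝ) * I)).re)
        atTop (𝓝 p) := by
      have hc : ContinuousAt (cauchyTransform B) (z + ((0 : ℝ) : ℂ) * I) := by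
        refine (differentiableOn_cauchyTransform hfin).continuousOn.continuousAt
          ((isOpen_halfPlane 0).mem_nhds ?_)
        simpa using hz
      have h4 : Tendsto (fun m : ℕ => z + ((1 / ((m : ℝ) + 1) : ℝ) : ℂ) * I) atTop
          (𝓝 (z + ((0 : ℝ) : ℂ) * I)) :=
        (((continuous_ofReal.tendsto 0).comp tendsto_one_div_add_atTop_nhds_zero_nat).mul_const
          _).const_add _
      have h5 := (continuous_re.tendsto _).comp (hc.tendsto.comp h4)
      simpa [Function.comp_def] using h5
    obtain ⟨m, hm1, hm2⟩ := ((h1.eventually_lt_const h2).and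
      (h3.eventually_const_lt (half_lt_self hp0))).exists
    exact ⟨1 / ((m : ℝ) + 1), Nat.one_div_pos_of_nat, hm2, hm1⟩
  rw [Metric.tendsto_atTop]
  intro ε hε
  obtain ⟨N, hN0, hN⟩ : ∃ N : ℝ, 0 ≤ N ∧ (1 + M * 2) / ε < Real.exp (N * (p / 2)) := by
    have : Tendsto (fun N : ℝ => Real.exp (N * (p / 2))) atTop atTop :=
      Real.tendsto_exp_atTop.comp (tendsto_id.atTop_mul_const (half_pos hp0))
    exact ((eventually_ge_atTop 0).and (this.eventually_gt_atTop _)).exists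
  obtain ⟨δ, hδ, hδp, hδint⟩ := hshift N hN0
  set k : ℂ → ℂ := fun w => exp (N * cauchyTransform B (w + δ * I)) with hk
  have hqint : Integrable fun t : ℝ => (halfPlanePoisson z t : ℂ) * k t :=
    hPC.mul_bdd (hkcont N hδ).aestronglyMeasurable
      (.of_forall fun t => hkle hN0 hδ t (by simp))
  have hweak := tendsto_setIntegral_mul_of_tendsto_setIntegral hB.measurableSet hfbm hfbM hw hqint
  rw [Metric.tendsto_atTop] at hweak
  obtain ⟨n₀, hn₀⟩ := hweak 1 one_pos
  refine ⟨n₀, fun n hn => ?_⟩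
  have hinside := hn₀ n hn
  rw [dist_zero_right] at hinside ⊢
  have hrep := integral_halfPlanePoisson_mul_boundary hδ (hf n) (hM n) (hkdiff N)
    (hkle hN0 hδ) (hfb n) hz
  have htot : Integrable fun t : ℝ => ((halfPlanePoisson z t : ℂ) * k t) * fb n t :=
    hqint.mul_bdd (hfbm n) (hfbM n)
  have hsplit : f n z * k z = (∫ t in B, ((halfPlanePoisson z t : ℂ) * k t) * fb n t) +
      ∫ t in Bᶜ, ((halfPlanePoisson z t : ℂ) * k t) * fb n t := by
    rw [integral_add_compl hB.measurableSet htot, ← hrep]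
    congr 1
    ext t
    simp only [hk]
    ring
  have hout : ‖∫ t in Bᶜ, ((halfPlanePoisson z t : ℂ) * k t) * fb n t‖ ≤ M * 2 := by
    have hi : Integrable fun t : ℝ => M * (halfPlanePoisson z t * ‖k t‖) := by
      refine Integrable.const_mul (hqint.norm.congr (.of_forall fun t => ?_)) _
      simp only [norm_mul, norm_real, Real.norm_of_nonneg (hnonneg t)]
    refine (norm_integral_le_of_norm_le hi.integrableOn ?_).trans ?_
    · filter_upwards [ae_restrict_of_ae (hfbM n)] with t ht
      rw [norm_mul, norm_mul, norm_real, Real.norm_of_nonneg (hnonneg t), mul_comm M]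
      have := hnonneg t
      gcongr
    · rw [integral_const_mul]
      gcongr
  have hkz : Real.exp (N * (p / 2)) ≤ ‖k z‖ := by
    rw [hk]
    simp only [hknorm]
    gcongr
  have hprod : ‖f n z‖ * ‖k z‖ < 1 + M * 2 := by
    rw [← norm_mul, hsplit]
    exact (norm_add_le _ _).trans_lt (add_lt_add_of_lt_of_le hinside hout)
  rw [div_lt_iff₀ hε] at hN
  by_contra! hcon
  have : ε * Real.exp (N * (p / 2)) ≤ ‖f n z‖ * ‖k z‖ := by gcongr
  linarith

/-- Pointwise convergence to zero of uniformly bounded holomorphic functions is locally uniform. -/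
theorem tendstoLocallyUniformlyOn_zero_of_bounded {U : Set ℂ} (hU : IsOpen U) {f : ℕ → ℂ → ℂ}
    {M : ℝ} (hf : ∀ n, DifferentiableOn ℂ (f n) U) (hM : ∀ n, ∀ w ∈ U, ‖f n w‖ ≤ M)
    (hlim : ∀ z ∈ U, Tendsto (fun n => f n z) atTop (𝓝 0)) :
    TendstoLocallyUniformlyOn f 0 atTop U := by
  rw [Metric.tendstoLocallyUniformlyOn_iff]
  intro ε hε z hz
  obtain ⟨r, hr, hball⟩ := Metric.isOpen_iff.1 hU z hz
  have hM0 : 0 ≤ M := (norm_nonneg _).trans (hM 0 z hz)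
  set ρ := min r (ε * r / (4 * (2 * M + 1))) with hρ
  have hρ0 : 0 < ρ := by positivity
  refine ⟨Metric.ball z ρ, mem_nhdsWithin_of_mem_nhds (Metric.ball_mem_nhds z hρ0), ?_⟩
  have h1 := (hlim z hz).norm
  rw [norm_zero] at h1
  filter_upwards [h1.eventually_lt_const (half_pos hε)] with n hn w hw
  have hwρ : dist w z < ρ := hw
  have hwr : w ∈ Metric.ball z r := hwρ.trans_le (min_le_left _ _)
  have hlip : dist (f n w) (f n z) ≤ (2 * M + 1) / r * dist w z := by
    refine Complex.dist_le_div_mul_dist_of_mapsTo_ball ((hf n).mono hball) (fun v hv => ?_) hwr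
    rw [Metric.mem_closedBall, dist_eq_norm]
    have := norm_sub_le (f n v) (f n z)
    have := hM n v (hball hv)
    have := hM n z hz
    linarith
  have hsmall : (2 * M + 1) / r * dist w z ≤ ε / 4 := by
    calc _ ≤ (2 * M + 1) / r * (ε * r / (4 * (2 * M + 1))) := by
          gcongr
          exact hwρ.le.trans (min_le_right _ _)
      _ = ε / 4 := by field_simp
  rw [Pi.zero_apply, dist_zero_left]
  rw [dist_eq_norm] at hlip
  have := norm_sub_norm_le (f n w) (f n z)
  linarith

/-- The step-function approximation at scale `1 / m` of the integral of `(s + I)⁻¹` against an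
interval function `v`. -/
noncomputable def stepSum (m : ℕ) (v : ℝ → ℝ → ℝ) : ℂ :=
  ∑ j ∈ Finset.Ico (-(m : ℤ) ^ 2) ((m : ℤ) ^ 2),
    (((j / m : ℝ) : ℂ) + I)⁻¹ * (v (j / m) ((j + 1) / m) : ℂ)

theorem tendsto_stepSum {ι : Type*} {l : Filter ι} (m : ℕ) {v : ι → ℝ → ℝ → ℝ} {v₀ : ℝ → ℝ → ℝ}
    (h : ∀ c d, Tendsto (fun i => v i c d) l (𝓝 (v₀ c d))) :
    Tendsto (fun i => stepSum m (v i)) l (𝓝 (stepSum m v₀)) :=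
  tendsto_finsetSum _ fun _ _ => ((continuous_ofReal.tendsto _).comp (h _ _)).const_mul _

theorem one_le_norm_add_I {w : ℂ} (hw : 0 ≤ w.im) : 1 ≤ ‖w + I‖ := by
  have h := Complex.abs_im_le_norm (w + I)
  rw [add_im, I_im, abs_of_pos (by linarith)] at h
  linarith

theorem add_I_ne_zero {w : ℂ} (hw : 0 ≤ w.im) : w + I ≠ 0 :=
  norm_pos_iff.1 (one_pos.trans_le (one_le_norm_add_I hw))

theorem norm_inv_add_I_le_one {w : ℂ} (hw : 0 ≤ w.im) : ‖(w + I)⁻¹‖ ≤ 1 := by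
  rw [norm_inv]
  exact inv_le_one_of_one_le₀ (one_le_norm_add_I hw)

theorem norm_inv_add_I_sub_stepSum_indicator_le {m : ℕ} (hm : 0 < m) {t : ℝ}
    (ht : ∀ j : ℤ, t ≠ j / m) :
    ‖((t : ℂ) + I)⁻¹ - stepSum m (fun c d => (Set.Ioo c d).indicator 1 t)‖ ≤ 1 / m := by
  have hm0 : (0 : ℝ) < m := by exact_mod_cast hm
  set j₀ := ⌊t * m⌋ with hj₀
  have hle : (j₀ : ℝ) ≤ t * m := Int.floor_le _
  have hlt : t * m < j₀ + 1 := Int.lt_floor_add_one _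
  have hlow : (j₀ : ℝ) / m < t :=
    lt_of_le_of_ne ((div_le_iff₀ hm0).2 hle) (ht j₀).symm
  have hup : t < ((j₀ : ℝ) + 1) / m := (lt_div_iff₀ hm0).2 hlt
  have hind : ∀ j : ℤ, (Set.Ioo ((j : ℝ) / m) ((j + 1) / m)).indicator (1 : ℝ → ℝ) t =
      if j = j₀ then 1 else 0 := by
    intro j
    by_cases hj : j = j₀
    · rw [if_pos hj, Set.indicator_of_mem, Pi.one_apply]
      subst hj
      exact ⟨hlow, hup⟩
    · rw [if_neg hj, Set.indicator_of_notMem]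
      rintro ⟨h1, h2⟩
      rw [div_lt_iff₀ hm0] at h1
      rw [lt_div_iff₀ hm0] at h2
      exact hj (Int.floor_eq_iff.2 ⟨h1.le, h2⟩).symm
  have hsum : stepSum m (fun c d => (Set.Ioo c d).indicator 1 t) =
      if j₀ ∈ Finset.Ico (-(m : ℤ) ^ 2) ((m : ℤ) ^ 2) then (((j₀ / m : ℝ) : ℂ) + I)⁻¹ else 0 := by
    rw [stepSum, ← Finset.sum_ite_eq' _ j₀ (fun j : ℤ => (((j / m : ℝ) : ℂ) + I)⁻¹)]
    refine Finset.sum_congr rfl fun j _ => ?_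
    rw [hind]
    split_ifs <;> simp
  rw [hsum]
  split_ifs with hj
  · rw [inv_sub_inv (add_I_ne_zero (by simp)) (add_I_ne_zero (by simp)), norm_div, norm_mul]
    have h1 : 1 ≤ ‖(t : ℂ) + I‖ := one_le_norm_add_I (by simp)
    have h2 : 1 ≤ ‖(((j₀ / m : ℝ) : ℂ)) + I‖ := one_le_norm_add_I (by simp)
    have h3 : ‖(((j₀ / m : ℝ) : ℂ)) + I - (t + I)‖ ≤ 1 / m := by
      rw [add_sub_add_right_eq_sub, ← ofReal_sub, norm_real, Real.norm_eq_abs, abs_sub_comm,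
        abs_of_pos (sub_pos.2 hlow)]
      rw [add_div] at hup
      linarith
    exact (div_le_self (norm_nonneg _) (one_le_mul_of_one_le_of_one_le h1 h2)).trans h3
  · have habs : (m : ℝ) ≤ |t| := by
      rw [Finset.mem_Ico, not_and_or, not_le, not_lt] at hj
      rcases hj with hj | hj
      · have h : (j₀ : ℝ) + 1 ≤ -(m : ℝ) ^ 2 := by exact_mod_cast hj
        have : t ≤ -m := by
          by_contra! hc
          nlinarith
        exact (le_neg.2 this).trans (neg_le_abs t)
      · have h : (m : ℝ) ^ 2 ≤ j₀ := by exact_mod_cast hj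
        have : (m : ℝ) ≤ t := by
          by_contra! hc
          nlinarith
        exact this.trans (le_abs_self t)
    rw [sub_zero, norm_inv, ← one_div]
    refine one_div_le_one_div_of_le hm0 (habs.trans ?_)
    simpa using Complex.abs_re_le_norm ((t : ℂ) + I)

theorem norm_inv_add_I_sub_stepSum_harmMeas_le {m : ℕ} (hm : 0 < m) {z : ℂ} (hz : 0 < z.im) :
    ‖(z + I)⁻¹ - stepSum m (fun c d => harmMeas z (Set.Ioo c d))‖ ≤ 1 / m := by
  have hP := integrable_halfPlanePoisson hz
  have hPC : Integrable fun t : ℝ => (halfPlanePoisson z t : ℂ) := hP.ofReal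
  have hpoisson : ∫ t : ℝ, (halfPlanePoisson z t : ℂ) * ((t : ℂ) + I)⁻¹ = (z + I)⁻¹ := by
    refine integral_halfPlanePoisson_mul (G := fun w => (w + I)⁻¹) one_pos ?_
      (fun w hw => norm_inv_add_I_le_one hw) hz
    refine DifferentiableOn.inv (by fun_prop) fun w (hw : -1 < w.im) h => ?_
    have := congrArg Complex.im h
    simp at this
    linarith
  have hcont : Continuous fun t : ℝ => ((t : ℂ) + I)⁻¹ :=
    Continuous.inv₀ (by fun_prop) fun t => add_I_ne_zero (by simp)
  have hint1 : Integrable fun t : ℝ => (halfPlanePoisson z t : ℂ) * ((t : ℂ) + I)⁻¹ :=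
    hPC.mul_bdd hcont.aestronglyMeasurable (.of_forall fun t => norm_inv_add_I_le_one (by simp))
  have hterm : ∀ (a : ℂ) (c d : ℝ), Integrable fun t : ℝ =>
      a * ((halfPlanePoisson z t * (Set.Ioo c d).indicator 1 t : ℝ) : ℂ) := by
    intro a c d
    have h : Integrable fun t : ℝ => halfPlanePoisson z t * (Set.Ioo c d).indicator 1 t := by
      refine (hP.indicator (measurableSet_Ioo (a := c) (b := d))).congr (.of_forall fun t => ?_)
      by_cases ht : t ∈ Set.Ioo c d <;> simp [ht]
    exact h.ofReal.const_mul a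
  have hstep : ∀ t : ℝ, (halfPlanePoisson z t : ℂ) *
      stepSum m (fun c d => (Set.Ioo c d).indicator 1 t) =
      ∑ j ∈ Finset.Ico (-(m : ℤ) ^ 2) ((m : ℤ) ^ 2), (((j / m : ℝ) : ℂ) + I)⁻¹ *
        ((halfPlanePoisson z t * (Set.Ioo ((j : ℝ) / m) ((j + 1) / m)).indicator 1 t : ℝ) : ℂ) := by
    intro t
    rw [stepSum, Finset.mul_sum]
    refine Finset.sum_congr rfl fun j _ => ?_
    rw [ofReal_mul]
    ring
  have hint2 : Integrable fun t : ℝ => (halfPlanePoisson z t : ℂ) *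
      stepSum m (fun c d => (Set.Ioo c d).indicator 1 t) := by
    simp only [hstep]
    exact integrable_finsetSum _ fun j _ => hterm _ _ _
  have hharm : stepSum m (fun c d => harmMeas z (Set.Ioo c d)) =
      ∫ t : ℝ, (halfPlanePoisson z t : ℂ) *
        stepSum m (fun c d => (Set.Ioo c d).indicator 1 t) := by
    simp only [hstep]
    rw [integral_finsetSum _ fun j _ => hterm _ _ _, stepSum]
    refine Finset.sum_congr rfl fun j _ => ?_
    rw [integral_const_mul, integral_complex_ofReal, harmMeas_eq_integral_poisson,
      ← integral_indicator measurableSet_Ioo]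
    congr 3
    ext t
    by_cases ht : t ∈ Set.Ioo ((j : ℝ) / m) ((j + 1) / m) <;> simp [ht]
  rw [hharm, ← hpoisson, ← integral_sub hint1 hint2]
  refine (norm_integral_le_of_norm_le (hP.mul_const (1 / (m : ℝ))) ?_).trans_eq ?_
  · have hnull : ∀ᵐ t : ℝ, t ∉ Set.range fun j : ℤ => (j : ℝ) / m :=
      (Set.countable_range _).ae_notMem _
    filter_upwards [hnull] with t ht
    rw [← mul_sub, norm_mul, norm_real, Real.norm_of_nonneg (halfPlanePoisson_nonneg hz t)]
    refine mul_le_mul_of_nonneg_left ?_ (halfPlanePoisson_nonneg hz t)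
    exact norm_inv_add_I_sub_stepSum_indicator_le hm fun j hj => ht ⟨j, hj.symm⟩
  · rw [integral_mul_const, integral_halfPlanePoisson hz, one_mul]

theorem harmMeas_nonneg {z : ℂ} (hz : 0 < z.im) (S : Set ℝ) : 0 ≤ harmMeas z S := by
  rw [harmMeas_eq_integral_poisson]
  exact integral_nonneg fun t => halfPlanePoisson_nonneg hz t

theorem harmMeas_le_one {z : ℂ} (hz : 0 < z.im) (S : Set ℝ) : harmMeas z S ≤ 1 := by
  rw [harmMeas_eq_integral_poisson, ← integral_halfPlanePoisson hz]
  exact setIntegral_le_integral (integrable_halfPlanePoisson hz)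
    (.of_forall fun t => halfPlanePoisson_nonneg hz t)

theorem measurable_harmMeas (S : Set ℝ) : Measurable fun z => harmMeas z S := by
  simp only [harmMeas_eq_integral_poisson]
  exact (measurable_halfPlanePoisson.stronglyMeasurable.integral_prod_right
    (ν := volume.restrict S)).measurable

section Boundary

variable {F : ℂ → ℂ} {g : ℝ → ℝ → ℝ → ℝ}

theorem aestronglyMeasurable_boundary_harmMeas (hF : IsHerglotz F) {c d : ℝ} {u : ℝ → ℝ}
    (hu : ∀ᵐ t : ℝ, Tendsto (fun y : ℝ => harmMeas (F (t + y * I)) (Set.Ioo c d)) (𝓝[>] 0)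
      (𝓝 (u t))) : AEStronglyMeasurable u := by
  refine aestronglyMeasurable_of_tendsto_ae atTop
    (f := fun (m : ℕ) (t : ℝ) => harmMeas (F (t + (1 / ((m : ℝ) + 1) : ℝ) * I)) (Set.Ioo c d))
    (fun m => ?_) ?_
  · exact ((measurable_harmMeas _).comp (continuous_horizontal hF.1.continuousOn
      Nat.one_div_pos_of_nat).measurable).aestronglyMeasurable
  · filter_upwards [hu] with t ht
    exact ht.comp tendsto_one_div_add_one_nhdsGT_zero

theorem integrableOn_boundary_harmMeas (hF : IsHerglotz F) {c d : ℝ} {u : ℝ → ℝ}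
    (hu : ∀ᵐ t : ℝ, Tendsto (fun y : ℝ => harmMeas (F (t + y * I)) (Set.Ioo c d)) (𝓝[>] 0)
      (𝓝 (u t))) {A : Set ℝ} (hA : volume A < ⊤) : IntegrableOn u A := by
  refine IntegrableOn.of_bound hA (aestronglyMeasurable_boundary_harmMeas hF hu).restrict 1
    (ae_restrict_of_ae ?_)
  filter_upwards [hu] with t ht
  refine le_of_tendsto ht.norm ?_
  filter_upwards [self_mem_nhdsWithin] with y (hy : 0 < y)
  have him := hF.2 (t + y * I) (by simpa using hy)
  rw [Real.norm_of_nonneg (harmMeas_nonneg him _)]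
  exact harmMeas_le_one him _

theorem ae_exists_tendsto_inv_add_I (hF : IsHerglotz F)
    (hg : ∀ c d : ℝ, ∀ᵐ t : ℝ, Tendsto (fun y : ℝ => harmMeas (F (t + y * I)) (Set.Ioo c d))
      (𝓝[>] 0) (𝓝 (g c d t))) :
    ∀ᵐ t : ℝ, ∃ l : ℂ, Tendsto (fun y : ℝ => (F (t + y * I) + I)⁻¹) (𝓝[>] 0) (𝓝 l) ∧
      ∀ m : ℕ, 0 < m → ‖l - stepSum m (fun c d => g c d t)‖ ≤ 1 / m := by
  have hall : ∀ᵐ t : ℝ, ∀ (m : ℕ) (j : ℤ),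
      Tendsto (fun y : ℝ => harmMeas (F (t + y * I)) (Set.Ioo ((j : ℝ) / m) ((j + 1) / m)))
        (𝓝[>] 0) (𝓝 (g (j / m) ((j + 1) / m) t)) :=
    ae_all_iff.2 fun m => ae_all_iff.2 fun j => hg _ _
  filter_upwards [hall] with t ht
  have hstep : ∀ m : ℕ, Tendsto (fun y : ℝ =>
      stepSum m (fun c d => harmMeas (F (t + y * I)) (Set.Ioo c d))) (𝓝[>] 0)
      (𝓝 (stepSum m fun c d => g c d t)) := fun m =>
    tendsto_finsetSum _ fun j _ => ((continuous_ofReal.tendsto _).comp (ht m j)).const_mul _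
  have hclose : ∀ m : ℕ, 0 < m → ∀ᶠ y : ℝ in 𝓝[>] 0, ‖(F (t + y * I) + I)⁻¹ -
      stepSum m (fun c d => harmMeas (F (t + y * I)) (Set.Ioo c d))‖ ≤ 1 / m := by
    intro m hm
    filter_upwards [self_mem_nhdsWithin] with y (hy : 0 < y)
    exact norm_inv_add_I_sub_stepSum_harmMeas_le hm (hF.2 _ (by simpa using hy))
  have hcauchy : Cauchy (map (fun y : ℝ => (F (t + y * I) + I)⁻¹) (𝓝[>] 0)) := by
    refine Metric.cauchy_iff.2 ⟨inferInstance, fun ε hε => ?_⟩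
    obtain ⟨m, hm⟩ := exists_nat_one_div_lt (show 0 < ε / 4 by positivity)
    set S := stepSum (m + 1) (fun c d => g c d t) with hS
    refine ⟨Metric.ball S (ε / 2), ?_, fun x hx y hy => ?_⟩
    · rw [mem_map]
      filter_upwards [hclose (m + 1) m.succ_pos,
        Metric.tendsto_nhds.1 (hstep (m + 1)) (ε / 4) (by positivity)] with y h1 h2
      rw [Set.mem_preimage, Metric.mem_ball]
      have h3 := dist_triangle (F (t + y * I) + I)⁻¹
        (stepSum (m + 1) fun c d => harmMeas (F (t + y * I)) (Set.Ioo c d)) S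
      rw [← dist_eq_norm] at h1
      push_cast at h1
      linarith
    · have := dist_triangle_right x y S
      rw [Metric.mem_ball] at hx hy
      linarith
  obtain ⟨l, hl⟩ := cauchy_map_iff_exists_tendsto.1 hcauchy
  exact ⟨l, hl, fun m hm => le_of_tendsto (hl.sub (hstep m)).norm (hclose m hm)⟩

theorem norm_setIntegral_boundary_sub_stepSum_le (hF : IsHerglotz F)
    (hg : ∀ c d : ℝ, ∀ᵐ t : ℝ, Tendsto (fun y : ℝ => harmMeas (F (t + y * I)) (Set.Ioo c d))
      (𝓝[>] 0) (𝓝 (g c d t))) {l : ℝ → ℂ} {m : ℕ} {A : Set ℝ} (hA : volume A < ⊤)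
    (hlint : IntegrableOn l A)
    (hl : ∀ᵐ t : ℝ, ‖l t - stepSum m (fun c d => g c d t)‖ ≤ 1 / m) :
    ‖(∫ t in A, l t) - stepSum m (fun c d => ∫ t in A, g c d t)‖ ≤ 1 / m * volume.real A := by
  have hterm : ∀ (a : ℂ) (c d : ℝ), IntegrableOn (fun t => a * (g c d t : ℂ)) A := fun a c d =>
    (integrableOn_boundary_harmMeas hF (hg c d) hA).ofReal.const_mul a
  have hsum : stepSum m (fun c d => ∫ t in A, g c d t) =
      ∫ t in A, stepSum m (fun c d => g c d t) := by
    simp only [stepSum]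
    rw [integral_finsetSum _ fun j _ => hterm _ _ _]
    refine Finset.sum_congr rfl fun j _ => ?_
    rw [integral_const_mul, integral_complex_ofReal]
  have h_int : IntegrableOn (fun t => stepSum m (fun c d => g c d t)) A :=
    integrable_finsetSum _ fun j _ => hterm _ _ _
  rw [hsum, ← integral_sub hlint h_int]
  exact norm_setIntegral_le_of_norm_le_const_ae hA (ae_restrict_of_ae hl)

end Boundary

theorem differentiableOn_inv_add_I {F : ℂ → ℂ} (hF : IsHerglotz F) :
    DifferentiableOn ℂ (fun w => (F w + I)⁻¹) {w | 0 < w.im} :=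
  (hF.1.add_const I).inv fun w hw => add_I_ne_zero (hF.2 w hw).le

theorem stmt7 (F : ℕ → ℂ → ℂ) (Flim : ℂ → ℂ)
    (hF : ∀ n, IsHerglotz (F n)) (hFlim : IsHerglotz Flim)
    (B : Set ℝ) (hB : MeasurableSet B)
    (hBfin : MeasureTheory.volume B < ⊤) (hBpos : 0 < MeasureTheory.volume B)
    -- boundary value functions t ↦ ω_{F_n(t)}((c,d)) and t ↦ ω_{F(t)}((c,d))
    (g : ℕ → ℝ → ℝ → ℝ → ℝ) (glim : ℝ → ℝ → ℝ → ℝ)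
    (hg : ∀ n, ∀ c d : ℝ, ∀ᵐ t : ℝ,
      Tendsto (fun y : ℝ => harmMeas (F n (t + y * Complex.I)) (Set.Ioo c d))
        (𝓝[>] 0) (𝓝 (g n c d t)))
    (hglim : ∀ c d : ℝ, ∀ᵐ t : ℝ,
      Tendsto (fun y : ℝ => harmMeas (Flim (t + y * Complex.I)) (Set.Ioo c d))
        (𝓝[>] 0) (𝓝 (glim c d t)))
    -- convergence over all Borel subsets A ⊆ B and all bounded open intervals J = (c,d)
    (hvd : ∀ A : Set ℝ, A ⊆ B → MeasurableSet A → ∀ c d : ℝ,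
      Tendsto (fun n => ∫ t in A, g n c d t) atTop (𝓝 (∫ t in A, glim c d t))) :
    ∀ K : Set ℂ, K ⊆ {z : ℂ | 0 < z.im} → IsCompact K →
      TendstoUniformlyOn (fun n => F n) Flim atTop K := by
  obtain ⟨B', hB'B, hB'c, hB'pos⟩ := hB.exists_lt_isCompact hBpos
  have hB'fin : volume B' < ⊤ := (measure_mono hB'B).trans_lt hBfin
  set l : (ℂ → ℂ) → ℝ → ℂ := fun G t =>
    limUnder (𝓝[>] (0 : ℝ)) fun y : ℝ => (G (t + y * I) + I)⁻¹ with hldef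
  have hl : ∀ {G : ℂ → ℂ} {u : ℝ → ℝ → ℝ → ℝ}, IsHerglotz G →
      (∀ c d : ℝ, ∀ᵐ t : ℝ, Tendsto (fun y : ℝ => harmMeas (G (t + y * I)) (Set.Ioo c d))
        (𝓝[>] 0) (𝓝 (u c d t))) →
      ∀ᵐ t : ℝ, Tendsto (fun y : ℝ => (G (t + y * I) + I)⁻¹) (𝓝[>] 0) (𝓝 (l G t)) ∧
        ∀ m : ℕ, 0 < m → ‖l G t - stepSum m (fun c d => u c d t)‖ ≤ 1 / m := by
    intro G u hG hu
    filter_upwards [ae_exists_tendsto_inv_add_I hG hu] with t ⟨a, ha, ham⟩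
    have : l G t = a := ha.limUnder_eq
    rw [this]
    exact ⟨ha, ham⟩
  have hlint : ∀ {G : ℂ → ℂ} {u : ℝ → ℝ → ℝ → ℝ}, IsHerglotz G →
      (∀ c d : ℝ, ∀ᵐ t : ℝ, Tendsto (fun y : ℝ => harmMeas (G (t + y * I)) (Set.Ioo c d))
        (𝓝[>] 0) (𝓝 (u c d t))) → ∀ {A : Set ℝ}, volume A < ⊤ → IntegrableOn (l G) A := by
    intro G u hG hu A hA
    have h1 : ∀ᵐ t : ℝ, Tendsto (fun y : ℝ => (G (t + y * I) + I)⁻¹) (𝓝[>] 0) (𝓝 (l G t)) :=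
      (hl hG hu).mono fun t ht => ht.1
    refine IntegrableOn.of_bound hA (aestronglyMeasurable_boundary (f := fun w => (G w + I)⁻¹)
      (differentiableOn_inv_add_I hG).continuousOn h1).restrict 1 (ae_restrict_of_ae ?_)
    filter_upwards [h1] with t ht
    exact norm_boundary_le (f := fun w => (G w + I)⁻¹)
      (fun w hw => norm_inv_add_I_le_one (hG.2 w hw).le) ht
  have hweak : ∀ A ⊆ B', MeasurableSet A →
      Tendsto (fun n => ∫ t in A, (l (F n) t - l Flim t)) atTop (𝓝 0) := by
    intro A hAB' hA
    have hAfin : volume A < ⊤ := (measure_mono hAB').trans_lt hB'fin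
    rw [Metric.tendsto_atTop]
    intro ε hε
    obtain ⟨m, hm⟩ := exists_nat_one_div_lt (show 0 < ε / (4 * (volume.real A + 1)) by positivity)
    have hstep := tendsto_stepSum (m + 1) (hvd A (hAB'.trans hB'B) hA)
    rw [Metric.tendsto_atTop] at hstep
    obtain ⟨n₀, hn₀⟩ := hstep (ε / 4) (by positivity)
    refine ⟨n₀, fun n hn => ?_⟩
    have hsmall : 1 / ((m + 1 : ℕ) : ℝ) * volume.real A ≤ ε / 4 := by
      push_cast
      calc _ ≤ ε / (4 * (volume.real A + 1)) * (volume.real A + 1) := by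
            gcongr
            linarith
        _ = ε / 4 := by field_simp
    have h1 := (norm_setIntegral_boundary_sub_stepSum_le (m := m + 1) (hF n) (hg n) hAfin
      (hlint (hF n) (hg n) hAfin)
      ((hl (hF n) (hg n)).mono fun t ht => ht.2 _ m.succ_pos)).trans hsmall
    have h2 := (norm_setIntegral_boundary_sub_stepSum_le (m := m + 1) hFlim hglim hAfin
      (hlint hFlim hglim hAfin)
      ((hl hFlim hglim).mono fun t ht => ht.2 _ m.succ_pos)).trans hsmall
    have h3 := hn₀ n hn
    rw [integral_sub (hlint (hF n) (hg n) hAfin) (hlint hFlim hglim hAfin), dist_zero_right,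
      ← dist_eq_norm]
    rw [← dist_eq_norm] at h1 h2
    rw [dist_comm] at h2
    have h4 := dist_triangle4 (∫ t in A, l (F n) t)
      (stepSum (m + 1) fun c d => ∫ t in A, g n c d t)
      (stepSum (m + 1) fun c d => ∫ t in A, glim c d t) (∫ t in A, l Flim t)
    linarith
  set f : ℕ → ℂ → ℂ := fun n w => (F n w + I)⁻¹ - (Flim w + I)⁻¹ with hfdef
  have hfdiff : ∀ n, DifferentiableOn ℂ (f n) {w | 0 < w.im} := fun n =>
    (differentiableOn_inv_add_I (hF n)).sub (differentiableOn_inv_add_I hFlim)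
  have hfM : ∀ n, ∀ w : ℂ, 0 < w.im → ‖f n w‖ ≤ 1 + 1 := fun n w hw =>
    (norm_sub_le _ _).trans (add_le_add (norm_inv_add_I_le_one ((hF n).2 w hw).le)
      (norm_inv_add_I_le_one (hFlim.2 w hw).le))
  have hpt : ∀ z ∈ {w : ℂ | 0 < w.im}, Tendsto (fun n => f n z) atTop (𝓝 0) := by
    intro z hz
    refine tendsto_zero_of_tendsto_setIntegral_boundary hfdiff hfM
      (fb := fun n t => l (F n) t - l Flim t) (fun n => ?_) hB'c.isClosed hB'fin hB'pos hweak hz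
    filter_upwards [hl (hF n) (hg n), hl hFlim hglim] with t h1 h2
    exact h1.1.sub h2.1
  have hloc := tendstoLocallyUniformlyOn_zero_of_bounded (isOpen_halfPlane 0) hfdiff hfM hpt
  have hinv : TendstoLocallyUniformlyOn (fun n w => (F n w + I)⁻¹) (fun w => (Flim w + I)⁻¹) atTop
      {w : ℂ | 0 < w.im} := by
    rw [Metric.tendstoLocallyUniformlyOn_iff] at hloc ⊢
    intro ε hε x hx
    obtain ⟨t, ht, h⟩ := hloc ε hε x hx
    refine ⟨t, ht, h.mono fun n hn y hy => ?_⟩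
    have := hn y hy
    rwa [Pi.zero_apply, dist_zero_left, ← dist_eq_norm, dist_comm] at this
  have hsum := hinv.inv₀ (differentiableOn_inv_add_I hFlim).continuousOn
    fun w hw => inv_ne_zero (add_I_ne_zero (hFlim.2 w hw).le)
  intro K hKU hK
  have hKunif :=
    (tendstoLocallyUniformlyOn_iff_forall_isCompact (isOpen_halfPlane 0)).1 hsum K hKU hK
  rw [Metric.tendstoUniformlyOn_iff] at hKunif ⊢
  intro ε hε
  filter_upwards [hKunif ε hε] with n hn x hx
  simpa using hn x hx
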